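/- arXiv:2402.18304 — 3 statements merged into one kernel-verified Lean document; each statement's English description precedes it below -/
import Mathlib

section
/- Let n ≥ 1 and ξ ≥ 1 and m ≥ 1 be natural numbers, let k ≥ 0 be a natural number of partitions, and let d_m > 0 be a real number with (k−1)/d_m ≥ 1. Define, for real ρ, B(ρ) = k·(1 − (1/n)·Σ_{j=1}^{ξ} (j : ℝ)^{−ρ}) + (1/m)·Σ_{i=1}^{m} d_m·( ((k−1)/d_m)^{1−ρ} + (i−1)/n )^{−1} + 1. Then B is monotone nondecreasing in ρ: for all real ρ_1 ≤ ρ_2, B(ρ_1) ≤ B(ρ_2). In particular, the replication-factor bound of the partitioner decreases as the power-law exponent ρ decreases. -/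
open Finset

/-- The full replication-factor bound
`B(ρ) = k·(1 - (1/n)·Σ_{j=1}^{ξ} j^{-ρ}) + (1/m)·Σ_{i=1}^{m} d_m·(((k-1)/d_m)^{1-ρ} + (i-1)/n)⁻¹ + 1`
is monotone nondecreasing in `ρ`; i.e. the bound decreases as `ρ` decreases. -/
theorem rf_bound_monotone (n ξ m k : ℕ) (hn : 1 ≤ n) (hξ : 1 ≤ ξ) (hm : 1 ≤ m)
    (dm : ℝ) (hdm : 0 < dm) (hk : 1 ≤ ((k : ℝ) - 1) / dm) :
    Monotone (fun ρ : ℝ =>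
      (k : ℝ) * (1 - (1 / (n : ℝ)) * ∑ j ∈ Finset.Icc 1 ξ, (j : ℝ) ^ (-ρ))
      + (1 / (m : ℝ)) * ∑ i ∈ Finset.Icc 1 m,
          dm * ((((k : ℝ) - 1) / dm) ^ ((1 : ℝ) - ρ) + ((i : ℝ) - 1) / (n : ℝ))⁻¹
      + 1) := by
  intro ρ₁ ρ₂ h
  beta_reduce
  have hbase : 0 < ((k : ℝ) - 1) / dm := by linarith
  gcongr with j hj i hi
  · exact_mod_cast (Finset.mem_Icc.mp hj).1
  · have hi' : (0 : ℝ) ≤ (i : ℝ) - 1 :=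
      sub_nonneg.mpr (by exact_mod_cast (Finset.mem_Icc.mp hi).1)
    positivity
end

section
/- Let C be a finite set of clusters, w : C → ℝ nonnegative with total weight W = Σ_c w(c) > 0, θ : C → C → ℝ nonnegative and symmetric, and k ≥ 1. Define F̄(c) = Σ_{c' ≠ c} θ(c, c'), T = Σ_{c ∈ C} (F̄(c) + w(c)), and set δ = k·T/W². Then for every assignment f : C → Fin k, the social welfare S(f) = (δ/k)·Σ_p ℓ(p)² + (1/k)·Σ_p (cut(p) + ℓ(p)) satisfies S(f) ≤ ((k+1)/k)·T, where ℓ(p) = Σ_{c : f(c)=p} w(c), F(c) = Σ_{c'} θ(c,c')·𝟙[f(c) ≠ f(c')], and cut(p) = Σ_{c : f(c)=p} F(c). -/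
/-- Load of partition `p`: total weight of clusters assigned to `p`. -/
noncomputable def load {C : Type*} [Fintype C] {k : ℕ} (w : C → ℝ) (f : C → Fin k)
    (p : Fin k) : ℝ :=
  ∑ c ∈ Finset.univ.filter (fun c => f c = p), w c

/-- `F(c)`: total inter-cluster edge count of `c` towards clusters in other partitions. -/
noncomputable def Fcost {C : Type*} [Fintype C] {k : ℕ} (θ : C → C → ℝ) (f : C → Fin k)
    (c : C) : ℝ :=
  ∑ c', θ c c' * (if f c ≠ f c' then 1 else 0)

/-- `cut(p)`: sum of `F(c)` over clusters `c` assigned to partition `p`. -/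
noncomputable def cut {C : Type*} [Fintype C] {k : ℕ} (θ : C → C → ℝ) (w : C → ℝ)
    (f : C → Fin k) (p : Fin k) : ℝ :=
  ∑ c ∈ Finset.univ.filter (fun c => f c = p), Fcost θ f c

theorem sum_load {C : Type*} [Fintype C] {k : ℕ} (w : C → ℝ) (f : C → Fin k) :
    ∑ p, load w f p = ∑ c, w c :=
  Finset.sum_fiberwise _ _ _

theorem sum_cut {C : Type*} [Fintype C] {k : ℕ} (θ : C → C → ℝ) (w : C → ℝ)
    (f : C → Fin k) : ∑ p, cut θ w f p = ∑ c, Fcost θ f c :=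
  Finset.sum_fiberwise _ _ _

theorem load_nonneg {C : Type*} [Fintype C] {k : ℕ} {w : C → ℝ} (hw : ∀ c, 0 ≤ w c)
    (f : C → Fin k) (p : Fin k) : 0 ≤ load w f p :=
  Finset.sum_nonneg fun c _ => hw c

theorem sum_load_sq_le {C : Type*} [Fintype C] {k : ℕ} {w : C → ℝ} (hw : ∀ c, 0 ≤ w c)
    (f : C → Fin k) : ∑ p, load w f p ^ 2 ≤ (∑ c, w c) ^ 2 := by
  rw [← sum_load w f]
  exact Finset.sum_sq_le_sq_sum_of_nonneg fun p _ => load_nonneg hw f p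

theorem Fcost_le_sum_erase {C : Type*} [Fintype C] [DecidableEq C] {k : ℕ} {θ : C → C → ℝ}
    (hθ : ∀ c c', 0 ≤ θ c c') (f : C → Fin k) (c : C) :
    Fcost θ f c ≤ ∑ c' ∈ Finset.univ.erase c, θ c c' := by
  rw [Fcost, ← Finset.add_sum_erase _ _ (Finset.mem_univ c)]
  simp only [ne_eq, not_true_eq_false, if_false, mul_zero, zero_add]
  refine Finset.sum_le_sum fun c' _ => mul_le_of_le_one_right (hθ c c') ?_
  split_ifs <;> norm_num

/-- With `δ = k·T/W²`, the social welfare of any assignment is at most `((k+1)/k)·T`,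
where `T = Σ_c (F̄(c) + w(c))` and `F̄(c) = Σ_{c'≠c} θ(c,c')`. -/
theorem social_welfare_upper_bound {C : Type*} [Fintype C] [DecidableEq C]
    (w : C → ℝ) (hw : ∀ c, 0 ≤ w c) (hW : 0 < ∑ c, w c)
    (θ : C → C → ℝ) (hθ : ∀ c c', 0 ≤ θ c c') (hsym : ∀ c c', θ c c' = θ c' c)
    (k : ℕ) (hk : 1 ≤ k) (f : C → Fin k) :
    ((k : ℝ) * (∑ c, ((∑ c' ∈ Finset.univ.erase c, θ c c') + w c)) / (∑ c, w c) ^ 2 / k)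
        * ∑ p : Fin k, (load w f p) ^ 2
      + (1 / k) * ∑ p : Fin k, (cut θ w f p + load w f p)
      ≤ ((k : ℝ) + 1) / k * ∑ c, ((∑ c' ∈ Finset.univ.erase c, θ c c') + w c) := by
  have hk' : (0 : ℝ) < k := by exact_mod_cast hk
  have hsq := sum_load_sq_le hw f
  have hcost : ∑ p : Fin k, (cut θ w f p + load w f p)
      ≤ ∑ c, ((∑ c' ∈ Finset.univ.erase c, θ c c') + w c) := by
    rw [Finset.sum_add_distrib, sum_cut, sum_load, ← Finset.sum_add_distrib]
    gcongr with c
    exact Fcost_le_sum_erase hθ f c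
  have hT : 0 ≤ ∑ c, ((∑ c' ∈ Finset.univ.erase c, θ c c') + w c) :=
    Finset.sum_nonneg fun c _ => add_nonneg (Finset.sum_nonneg fun c' _ => hθ c c') (hw c)
  set T := ∑ c, ((∑ c' ∈ Finset.univ.erase c, θ c c') + w c)
  calc _ ≤ (k : ℝ) * T / (∑ c, w c) ^ 2 / k * (∑ c, w c) ^ 2 + (1 / k) * T := by gcongr
    _ = ((k : ℝ) + 1) / k * T := by field_simp
end

section
/- Let C be a finite set of clusters, w : C → ℝ nonnegative with total weight W = Σ_c w(c) > 0, θ : C → C → ℝ nonnegative and symmetric, and k ≥ 1. Define F̄(c) = Σ_{c' ≠ c} θ(c, c'), T = Σ_{c ∈ C} (F̄(c) + w(c)), and set δ = k·T/W². Then for every assignment f : C → Fin k, the social welfare S(f) = (δ/k)·Σ_p ℓ(p)² + (1/k)·Σ_p (cut(p) + ℓ(p)) satisfies S(f) ≥ T/k, where ℓ(p) = Σ_{c : f(c)=p} w(c), F(c) = Σ_{c'} θ(c,c')·𝟙[f(c) ≠ f(c')], and cut(p) = Σ_{c : f(c)=p} F(c). -/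
/-- With `δ = k·T/W²`, the social welfare of any assignment is at least `T/k`,
where `T = Σ_c (F̄(c) + w(c))` and `F̄(c) = Σ_{c'≠c} θ(c,c')`. -/
theorem social_welfare_lower_bound {C : Type*} [Fintype C] [DecidableEq C]
    (w : C → ℝ) (hw : ∀ c, 0 ≤ w c) (hW : 0 < ∑ c, w c)
    (θ : C → C → ℝ) (hθ : ∀ c c', 0 ≤ θ c c') (hsym : ∀ c c', θ c c' = θ c' c)
    (k : ℕ) (hk : 1 ≤ k) (f : C → Fin k) :
    (∑ c, ((∑ c' ∈ Finset.univ.erase c, θ c c') + w c)) / k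
      ≤ ((k : ℝ) * (∑ c, ((∑ c' ∈ Finset.univ.erase c, θ c c') + w c)) / (∑ c, w c) ^ 2 / k)
          * ∑ p : Fin k, (load w f p) ^ 2
        + (1 / k) * ∑ p : Fin k, (cut θ w f p + load w f p) := by
  have hk0 : (0 : ℝ) < k := by exact_mod_cast hk
  have hT : 0 ≤ ∑ c, ((∑ c' ∈ Finset.univ.erase c, θ c c') + w c) :=
    Finset.sum_nonneg fun c _ => add_nonneg (Finset.sum_nonneg fun c' _ => hθ c c') (hw c)
  have hsum : ∑ p, load w f p = ∑ c, w c := Finset.sum_fiberwise _ _ _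
  have hsq : (∑ c, w c) ^ 2 ≤ k * ∑ p, (load w f p) ^ 2 := by
    simpa [hsum] using sq_sum_le_card_mul_sum_sq (s := Finset.univ) (f := load w f)
  have hload : ∀ p, 0 ≤ load w f p := fun p => Finset.sum_nonneg fun c _ => hw c
  have hcut : ∀ p, 0 ≤ cut θ w f p := fun p =>
    Finset.sum_nonneg fun c _ => Finset.sum_nonneg fun c' _ =>
      mul_nonneg (hθ c c') (by split_ifs <;> norm_num)
  have hcost : 0 ≤ (1 / (k : ℝ)) * ∑ p, (cut θ w f p + load w f p) :=
    mul_nonneg (by positivity) (Finset.sum_nonneg fun p _ => add_nonneg (hcut p) (hload p))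
  refine le_add_of_le_of_nonneg ?_ hcost
  generalize ∑ c, ((∑ c' ∈ Finset.univ.erase c, θ c c') + w c) = T at hT ⊢
  generalize ∑ c, w c = W at hW hsq ⊢
  generalize ∑ p, (load w f p) ^ 2 = L at hsq ⊢
  have hcoef : (k : ℝ) * T / W ^ 2 / k * L = T * L / W ^ 2 := by
    field_simp
  rw [hcoef, div_le_div_iff₀ hk0 (by positivity)]
  nlinarith [mul_le_mul_of_nonneg_left hsq hT]
end
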